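/- Let f ∈ 𝓒 and θ ∈ ℝ. The function μ ↦ θ μ[f] − D(μ||u) attains its supremum over 𝓜 at a unique measure μ_{f,θ} ∈ 𝓜. Moreover, if π is drawn from Q_{n,f,θ}, then the empirical measure ν_π converges weakly in probability to μ_{f,θ}: for every continuous φ : [0,1]² → ℝ and every ε > 0, Q_{n,f,θ}({π ∈ S_n : |ν_π[φ] − μ_{f,θ}[φ]| > ε}) → 0 as n → ∞. -/

import Mathlib

open MeasureTheory Filter Topology
open scoped ENNReal

noncomputable section

/-- The unit square `[0,1]²` in `ℝ × ℝ`. -/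
def unitSq : Set (ℝ × ℝ) := Set.Icc 0 1 ×ˢ Set.Icc 0 1

/-- Lebesgue measure restricted to `[0,1]`. -/
def unif01 : Measure ℝ := volume.restrict (Set.Icc 0 1)

/-- Lebesgue (uniform) measure on the unit square. -/
def usq : Measure (ℝ × ℝ) := unif01.prod unif01

/-- `𝓜`: Borel probability measures on `[0,1]²` with both marginals Lebesgue on `[0,1]`. -/
def MM : Set (Measure (ℝ × ℝ)) :=
  {μ | IsProbabilityMeasure μ ∧ μ.map Prod.fst = unif01 ∧ μ.map Prod.snd = unif01}

/-- The class `𝓒` of continuous functions on the unit square, not identically zero,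
with all row and column integrals vanishing. -/
def memC (f : ℝ × ℝ → ℝ) : Prop :=
  ContinuousOn f unitSq ∧ (∃ p ∈ unitSq, f p ≠ 0) ∧
    (∀ x ∈ Set.Icc (0 : ℝ) 1, (∫ z in (0 : ℝ)..1, f (x, z)) = 0) ∧
    (∀ y ∈ Set.Icc (0 : ℝ) 1, (∫ z in (0 : ℝ)..1, f (z, y)) = 0)

open scoped Classical in
/-- Kullback–Leibler divergence `D(μ‖ν)`, equal to `∫ log(dμ/dν) dμ` when `μ ≪ ν`
(and this integral exists), and `+∞` otherwise. -/
def KL (μ ν : Measure (ℝ × ℝ)) : ℝ≥0∞ :=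
  if μ ≪ ν ∧ Integrable (fun x => Real.log ((μ.rnDeriv ν x).toReal)) μ then
    ENNReal.ofReal (∫ x, Real.log ((μ.rnDeriv ν x).toReal) ∂μ)
  else ⊤

/-- The objective `θ μ[f] − D(μ‖u)`, as an extended real. -/
def objE (f : ℝ × ℝ → ℝ) (θ : ℝ) (μ : Measure (ℝ × ℝ)) : EReal :=
  ((θ * ∫ p, f p ∂μ : ℝ) : EReal) - (KL μ usq : EReal)

/-- `∑_{i=1}^n f(i/n, π(i)/n)`. -/
def permStat (f : ℝ × ℝ → ℝ) (n : ℕ) (π : Equiv.Perm (Fin n)) : ℝ :=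
  ∑ i : Fin n, f ((i.1 + 1 : ℝ) / n, ((π i).1 + 1 : ℝ) / n)

/-- The log normalizing constant `Z_n(f,θ)`. -/
def Zn (f : ℝ × ℝ → ℝ) (θ : ℝ) (n : ℕ) : ℝ :=
  Real.log (∑ π : Equiv.Perm (Fin n), Real.exp (θ * permStat f n π))

open scoped Classical in
/-- The probability that a sample from `Q_{n,f,θ}` satisfies `p`. -/
def Qprob (f : ℝ × ℝ → ℝ) (θ : ℝ) (n : ℕ) (p : Equiv.Perm (Fin n) → Prop) : ℝ :=
  ∑ π : Equiv.Perm (Fin n), if p π then Real.exp (θ * permStat f n π - Zn f θ n) else 0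

section Deviation

open ProbabilityTheory

variable {Ω : Type*} [MeasurableSpace Ω]

/-- Hoeffding's one-sided bound for empirical averages under a power of a probability measure. -/
theorem pi_upper_deviation_le (μ : Measure Ω) [IsProbabilityMeasure μ] {g : Ω → ℝ}
    (hg : Measurable g) {B : ℝ} (hB : 0 < B) (hgB : ∀ ω, |g ω| ≤ B) {ε : ℝ} (hε : 0 ≤ ε) (n : ℕ) :
    (Measure.pi fun _ : Fin n => μ).real {p | n * ε ≤ ∑ i, (g (p i) - ∫ ω, g ω ∂μ)} ≤
      Real.exp (-(ε ^ 2 / (2 * B ^ 2)) * n) := by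
  have hind : iIndepFun (fun (i : Fin n) (p : Fin n → Ω) => g (p i) - ∫ ω, g ω ∂μ)
      (Measure.pi fun _ : Fin n => μ) :=
    iIndepFun_pi (X := fun _ ω => g ω - ∫ ω, g ω ∂μ) fun _ => (hg.sub_const _).aemeasurable
  have hsub : ∀ i : Fin n, HasSubgaussianMGF (fun p : Fin n → Ω => g (p i) - ∫ ω, g ω ∂μ)
      ((‖B - -B‖₊ / 2) ^ 2) (Measure.pi fun _ : Fin n => μ) := by
    intro i
    have h := hasSubgaussianMGF_of_mem_Icc (μ := μ) (a := -B) (b := B) hg.aemeasurable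
      (ae_of_all _ fun ω => abs_le.1 (hgB ω))
    generalize ∫ ω, g ω ∂μ = m at h ⊢
    rw [← (measurePreserving_eval (fun _ : Fin n => μ) i).map_eq] at h
    exact HasSubgaussianMGF.of_map (μ := Measure.pi fun _ : Fin n => μ) (Y := Function.eval i)
      (measurable_pi_apply i).aemeasurable h
  have h := HasSubgaussianMGF.measure_sum_ge_le_of_iIndepFun hind (s := Finset.univ)
    (fun i _ => hsub i) (ε := n * ε) (by positivity)
  refine h.trans (Real.exp_le_exp.2 (le_of_eq ?_))
  have hB2 : (‖B - -B‖ / 2) = B := by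
    rw [Real.norm_of_nonneg (by linarith)]; ring
  simp only [Finset.sum_const, Finset.card_univ, Fintype.card_fin, nsmul_eq_mul]
  push_cast
  rw [hB2]
  rcases Nat.eq_zero_or_pos n with rfl | hn
  · simp
  · have : (n : ℝ) ≠ 0 := by positivity
    field_simp

/-- Exponential concentration of empirical averages under a power of a probability measure. -/
theorem pi_deviation_le (μ : Measure Ω) [IsProbabilityMeasure μ] {g : Ω → ℝ}
    (hg : Measurable g) {B : ℝ} (hgB : ∀ ω, |g ω| ≤ B) {ε : ℝ} (hε : 0 < ε) :
    ∃ c > 0, ∀ n : ℕ, (Measure.pi fun _ : Fin n => μ).real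
      {p | ε ≤ |(∑ i, g (p i)) / n - ∫ ω, g ω ∂μ|} ≤ 2 * Real.exp (-c * n) := by
  obtain ⟨C, hC, hgC⟩ : ∃ C > 0, ∀ ω, |g ω| ≤ C :=
    ⟨max B 1, by positivity, fun ω => (hgB ω).trans (le_max_left _ _)⟩
  refine ⟨ε ^ 2 / (2 * C ^ 2), by positivity, fun n => ?_⟩
  rcases Nat.eq_zero_or_pos n with rfl | hn
  · exact measureReal_le_one.trans (by norm_num)
  have h1 := pi_upper_deviation_le μ hg hC hgC hε.le n
  have h2 := pi_upper_deviation_le μ hg.neg hC (fun ω => by simpa using hgC ω) hε.le n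
  have hn' : (0 : ℝ) < n := by exact_mod_cast hn
  calc _ ≤ (Measure.pi fun _ : Fin n => μ).real
        ({p | n * ε ≤ ∑ i, (g (p i) - ∫ ω, g ω ∂μ)} ∪
          {p | n * ε ≤ ∑ i, ((-g) (p i) - ∫ ω, (-g) ω ∂μ)}) := by
        refine measureReal_mono fun p hp => ?_
        simp only [Set.mem_ofPred_eq, Set.mem_union, Finset.sum_sub_distrib, Finset.sum_const,
          Finset.card_univ, Fintype.card_fin, nsmul_eq_mul, Pi.neg_apply, integral_neg,
          Finset.sum_neg_distrib] at hp ⊢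
        have hs : (∑ i, g (p i)) / n * n = ∑ i, g (p i) := by field_simp
        rcases le_abs.1 hp with h | h
        · left; nlinarith [mul_le_mul_of_nonneg_left h hn'.le]
        · right; nlinarith [mul_le_mul_of_nonneg_left h hn'.le]
    _ ≤ _ := measureReal_union_le _ _
    _ ≤ _ := by linarith

end Deviation

instance : IsProbabilityMeasure unif01 := ⟨by simp [unif01]⟩

instance : IsProbabilityMeasure usq := by unfold usq; infer_instance

theorem unif01_ae_mem : ∀ᵐ x ∂unif01, x ∈ Set.Icc (0 : ℝ) 1 :=
  ae_restrict_mem measurableSet_Icc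

theorem integral_indicator_Iic_unif01 {t : ℝ} (ht : t ∈ Set.Icc (0 : ℝ) 1) :
    ∫ x, (Set.Iic t).indicator (fun _ => (1 : ℝ)) x ∂unif01 = t := by
  have h : Set.Iic t ∩ Set.Icc (0 : ℝ) 1 = Set.Icc 0 t := by
    ext x
    simp only [Set.mem_inter_iff, Set.mem_Iic, Set.mem_Icc]
    constructor
    · rintro ⟨h1, h2, h3⟩; exact ⟨h2, h1⟩
    · rintro ⟨h1, h2⟩; exact ⟨h2, h1, h2.trans ht.2⟩
  rw [integral_indicator measurableSet_Iic]
  simp [unif01, Measure.restrict_restrict measurableSet_Iic, h, ht.1]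

/-- Tuples in `[0,1]ⁿ` whose order statistics are within `δ` of `1/n, 2/n, …, 1`. -/
def goodSet (n : ℕ) (δ : ℝ) : Set (Fin n → ℝ) :=
  {x | ∃ σ : Equiv.Perm (Fin n), ∀ j,
    x (σ j) ∈ Set.Icc (0 : ℝ) 1 ∧ |x (σ j) - (j.1 + 1 : ℝ) / n| ≤ δ}

theorem measurableSet_goodSet (n : ℕ) (δ : ℝ) : MeasurableSet (goodSet n δ) := by
  have : goodSet n δ = ⋃ σ : Equiv.Perm (Fin n), ⋂ j,
      {x | x (σ j) ∈ Set.Icc (0 : ℝ) 1} ∩ {x | |x (σ j) - (j.1 + 1 : ℝ) / n| ≤ δ} := by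
    ext x; simp [goodSet]
  rw [this]
  refine MeasurableSet.iUnion fun σ => MeasurableSet.iInter fun j => MeasurableSet.inter ?_ ?_
  · exact measurable_pi_apply (σ j) measurableSet_Icc
  · exact measurableSet_le (by fun_prop) measurable_const

theorem comp_mem_goodSet_iff {n : ℕ} {δ : ℝ} (τ : Equiv.Perm (Fin n)) (x : Fin n → ℝ) :
    x ∘ τ ∈ goodSet n δ ↔ x ∈ goodSet n δ := by
  constructor
  · rintro ⟨σ, h⟩; exact ⟨σ.trans τ, h⟩
  · rintro ⟨σ, h⟩; exact ⟨σ.trans τ.symm, by simpa using h⟩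

/-- Closeness of the empirical distribution function to the identity on a grid of mesh `1 / K`
forces the order statistics to be close to `1/n, …, 1`. -/
theorem mem_goodSet_of_cdf_close {n K : ℕ} (hn : 0 < n) (hK : 0 < K) {x : Fin n → ℝ}
    (hx : ∀ i, x i ∈ Set.Icc (0 : ℝ) 1)
    (h : ∀ k : Fin (K + 1), |(∑ i, (Set.Iic ((k : ℕ) / K : ℝ)).indicator (fun _ => (1 : ℝ)) (x i)) / n
      - (k : ℕ) / K| < 1 / K) :
    x ∈ goodSet n (2 / K) := by
  have hn' : (0 : ℝ) < n := by exact_mod_cast hn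
  have hK' : (0 : ℝ) < K := by exact_mod_cast hK
  have hmono : Monotone (x ∘ Tuple.sort x) := Tuple.monotone_sort x
  refine ⟨Tuple.sort x, fun j => ⟨hx _, ?_⟩⟩
  set σ := Tuple.sort x
  have hxj := hx (σ j)
  have hcount : ∀ t : ℝ, ∑ i, (Set.Iic t).indicator (fun _ => (1 : ℝ)) (x i) =
      ((Finset.univ.filter fun i => x (σ i) ≤ t).card : ℝ) := by
    intro t
    rw [← Equiv.sum_comp σ, Finset.card_filter]
    simp [Set.indicator_apply]
  have hceil : (⌈K * x (σ j)⌉₊ : ℝ) < K * x (σ j) + 1 :=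
    Nat.ceil_lt_add_one (mul_nonneg hK'.le hxj.1)
  have hceil' : K * x (σ j) ≤ (⌈K * x (σ j)⌉₊ : ℝ) := Nat.le_ceil _
  have hle : ⌈K * x (σ j)⌉₊ ≤ K := Nat.ceil_le.2 (by nlinarith [hxj.2])
  have h2K : (2 : ℝ) / K = 1 / K + 1 / K := by ring
  rw [abs_sub_le_iff]
  constructor
  · rcases hxj.1.eq_or_lt with h0 | h0
    · have : (0 : ℝ) ≤ (j.1 + 1 : ℝ) / n := by positivity
      have : (0 : ℝ) ≤ 2 / K := by positivity
      rw [← h0]; linarith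
    · have hpos : 0 < ⌈K * x (σ j)⌉₊ := Nat.ceil_pos.2 (by positivity)
      obtain ⟨k, hk⟩ : ∃ k, ⌈K * x (σ j)⌉₊ = k + 1 := ⟨_, (Nat.succ_pred_eq_of_pos hpos).symm⟩
      rw [hk] at hceil hceil' hle
      push_cast at hceil hceil'
      have hlt : (k : ℝ) / K < x (σ j) := by
        rw [div_lt_iff₀ hK']; linarith
      have hk1 : x (σ j) ≤ (k : ℝ) / K + 1 / K := by
        rw [← add_div, le_div_iff₀ hK']; linarith
      have := (abs_lt.1 (h ⟨k, by omega⟩)).1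
      rw [hcount] at this
      have hcard : (Finset.univ.filter fun i => x (σ i) ≤ (k : ℝ) / K).card ≤ j.1 := by
        rw [← Fin.card_Iio j]
        refine Finset.card_le_card fun i hi => ?_
        rw [Finset.mem_Iio]
        by_contra hij
        have := hmono (not_lt.1 hij)
        simp only [Finset.mem_filter, Function.comp_apply] at hi this
        linarith [hi.2]
      have hcard' : ((Finset.univ.filter fun i => x (σ i) ≤ (k : ℝ) / K).card : ℝ) / n ≤
          (j.1 + 1 : ℝ) / n := by
        have : ((Finset.univ.filter fun i => x (σ i) ≤ (k : ℝ) / K).card : ℝ) ≤ j.1 := by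
          exact_mod_cast hcard
        gcongr; linarith
      simp only at this
      linarith
  · have := (abs_lt.1 (h ⟨⌈K * x (σ j)⌉₊, by omega⟩)).2
    rw [hcount] at this
    have hxk : x (σ j) ≤ (⌈K * x (σ j)⌉₊ : ℝ) / K := by rw [le_div_iff₀ hK']; linarith
    have hkx : (⌈K * x (σ j)⌉₊ : ℝ) / K ≤ x (σ j) + 1 / K := by
      rw [div_le_iff₀ hK', add_mul, one_div, inv_mul_cancel₀ hK'.ne']; linarith
    have hcard : j.1 + 1 ≤
        (Finset.univ.filter fun i => x (σ i) ≤ (⌈K * x (σ j)⌉₊ : ℝ) / K).card := by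
      rw [← Fin.card_Iic j]
      refine Finset.card_le_card fun i hi => ?_
      rw [Finset.mem_Iic] at hi
      simp only [Finset.mem_filter, Finset.mem_univ, true_and]
      exact (hmono hi).trans hxk
    have hcard' : (j.1 + 1 : ℝ) / n ≤
        ((Finset.univ.filter fun i => x (σ i) ≤ (⌈K * x (σ j)⌉₊ : ℝ) / K).card : ℝ) / n := by
      gcongr; exact_mod_cast hcard
    simp only at this
    linarith

theorem goodSet_mono {n : ℕ} {δ δ' : ℝ} (h : δ ≤ δ') : goodSet n δ ⊆ goodSet n δ' := by
  rintro x ⟨σ, hσ⟩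
  exact ⟨σ, fun j => ⟨(hσ j).1, (hσ j).2.trans h⟩⟩

theorem tendsto_pi_compl_goodSet {δ : ℝ} (hδ : 0 < δ) :
    Tendsto (fun n : ℕ => (Measure.pi fun _ : Fin n => unif01).real (goodSet n δ)ᶜ)
      atTop (𝓝 0) := by
  obtain ⟨K, hK⟩ := exists_nat_gt (2 / δ)
  have hK' : (0 : ℝ) < K := lt_trans (by positivity) hK
  have hK0 : 0 < K := by exact_mod_cast hK'
  have hKδ : 2 / (K : ℝ) ≤ δ := by
    rw [div_lt_iff₀ hδ] at hK; rw [div_le_iff₀ hK']; linarith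
  have hdev : ∀ k : Fin (K + 1), ∃ c > 0, ∀ n : ℕ, (Measure.pi fun _ : Fin n => unif01).real
      {x | 1 / (K : ℝ) ≤ |(∑ i, (Set.Iic ((k : ℕ) / K : ℝ)).indicator (fun _ => (1 : ℝ)) (x i)) / n
        - (k : ℕ) / K|} ≤ 2 * Real.exp (-c * n) := by
    intro k
    have hk : ((k : ℕ) / K : ℝ) ∈ Set.Icc (0 : ℝ) 1 :=
      ⟨by positivity, by
        rw [div_le_one hK']; exact_mod_cast Nat.lt_succ_iff.1 k.2⟩
    have := pi_deviation_le unif01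
      (g := (Set.Iic ((k : ℕ) / K : ℝ)).indicator (fun _ => (1 : ℝ)))
      (measurable_const.indicator measurableSet_Iic) (B := 1)
      (fun x => by
        by_cases h : x ≤ ((k : ℕ) / K : ℝ) <;> simp [h])
      (ε := 1 / K) (by positivity)
    rwa [integral_indicator_Iic_unif01 hk] at this
  choose c hc hbound using hdev
  have hlim : Tendsto (fun n : ℕ => ∑ k : Fin (K + 1), 2 * Real.exp (-c k * n)) atTop (𝓝 0) := by
    have : ∀ k : Fin (K + 1), Tendsto (fun n : ℕ => 2 * Real.exp (-c k * n)) atTop (𝓝 0) := by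
      intro k
      have h1 : Tendsto (fun n : ℕ => -c k * (n : ℝ)) atTop atBot :=
        tendsto_natCast_atTop_atTop.const_mul_atTop_of_neg (by linarith [hc k])
      simpa using (Real.tendsto_exp_atBot.comp h1).const_mul 2
    simpa using tendsto_finsetSum Finset.univ fun k _ => this k
  refine squeeze_zero' (Eventually.of_forall fun _ => measureReal_nonneg) ?_ hlim
  filter_upwards [eventually_gt_atTop 0] with n hn
  have hae : ∀ᵐ x ∂(Measure.pi fun _ : Fin n => unif01), ∀ i, x i ∈ Set.Icc (0 : ℝ) 1 := by
    rw [ae_all_iff]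
    intro i
    exact (measurePreserving_eval (fun _ : Fin n => unif01) i).quasiMeasurePreserving.ae
      unif01_ae_mem
  calc _ ≤ (Measure.pi fun _ : Fin n => unif01).real
        (⋃ k : Fin (K + 1), {x | 1 / (K : ℝ) ≤
          |(∑ i, (Set.Iic ((k : ℕ) / K : ℝ)).indicator (fun _ => (1 : ℝ)) (x i)) / n
            - (k : ℕ) / K|}) := by
        refine ENNReal.toReal_mono (measure_ne_top _ _) (measure_mono_ae ?_)
        filter_upwards [hae] with x hx hxg
        by_contra hcon
        refine hxg (goodSet_mono hKδ (mem_goodSet_of_cdf_close hn hK0 hx fun k => ?_))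
        by_contra hk
        exact hcon (Set.mem_iUnion.2 ⟨k, not_lt.1 hk⟩)
    _ ≤ _ := measureReal_iUnion_fintype_le _
    _ ≤ _ := Finset.sum_le_sum fun k _ => hbound k n

/-- A power of an exponentially tilted measure is the tilted power. -/
theorem pi_tilted_eq {Ω : Type*} [MeasurableSpace Ω] (u : Measure Ω) [IsProbabilityMeasure u]
    {g : Ω → ℝ} (hg1 : ∫ ω, Real.exp (g ω) ∂u = 1) (n : ℕ) :
    (Measure.pi fun _ : Fin n => u.tilted g) =
      (Measure.pi fun _ : Fin n => u).withDensity
        fun p => ENNReal.ofReal (Real.exp (∑ i, g (p i))) := by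
  have hint : Integrable (fun ω => Real.exp (g ω)) u :=
    not_imp_comm.1 integral_undef (by rw [hg1]; exact one_ne_zero)
  have hintpi : Integrable (fun p : Fin n → Ω => Real.exp (∑ i, g (p i)))
      (Measure.pi fun _ : Fin n => u) := by
    simp_rw [Real.exp_sum]
    exact Integrable.fintype_prod (f := fun _ ω => Real.exp (g ω)) fun _ => hint
  have : IsProbabilityMeasure (u.tilted g) := isProbabilityMeasure_tilted hint
  refine Measure.pi_eq fun s hs => ?_
  rw [withDensity_apply _ (MeasurableSet.univ_pi hs),
    ← ofReal_integral_eq_lintegral_ofReal hintpi.integrableOn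
      (ae_of_all _ fun _ => (Real.exp_pos _).le),
    ← integral_indicator (MeasurableSet.univ_pi hs)]
  have h1 : ∀ p : Fin n → Ω, (Set.pi Set.univ s).indicator
      (fun p : Fin n → Ω => Real.exp (∑ i, g (p i))) p =
      ∏ i, (s i).indicator (fun ω => Real.exp (g ω)) (p i) := by
    intro p
    by_cases hp : p ∈ Set.pi Set.univ s
    · rw [Set.indicator_of_mem hp, Real.exp_sum]
      refine Finset.prod_congr rfl fun i _ => ?_
      rw [Set.indicator_of_mem (hp i trivial)]
    · rw [Set.indicator_of_notMem hp]
      simp only [Set.mem_pi, Set.mem_univ, true_imp_iff, not_forall] at hp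
      obtain ⟨i, hi⟩ := hp
      exact (Finset.prod_eq_zero (Finset.mem_univ i) (Set.indicator_of_notMem hi _)).symm
  simp_rw [h1]
  rw [integral_fintype_prod_eq_prod (fun i => (s i).indicator (fun ω => Real.exp (g ω))),
    ENNReal.ofReal_prod_of_nonneg fun i _ => integral_nonneg fun ω =>
      Set.indicator_nonneg (fun _ _ => (Real.exp_pos _).le) _]
  refine Finset.prod_congr rfl fun i _ => ?_
  rw [integral_indicator (hs i), tilted_apply_eq_ofReal_integral' _ (hs i), hg1]
  simp

/-- The law of two independent tuples of independent uniform variables. -/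
def pairLaw (n : ℕ) : Measure ((Fin n → ℝ) × (Fin n → ℝ)) :=
  (Measure.pi fun _ => unif01).prod (Measure.pi fun _ => unif01)

instance (n : ℕ) : IsProbabilityMeasure (pairLaw n) := by unfold pairLaw; infer_instance

/-- The density `∏ᵢ exp (g (xᵢ, yᵢ))`. -/
def pairWeight (g : ℝ × ℝ → ℝ) (n : ℕ) (q : (Fin n → ℝ) × (Fin n → ℝ)) : ℝ≥0∞ :=
  ENNReal.ofReal (Real.exp (∑ i, g (q.1 i, q.2 i)))

theorem measurable_pairWeight {g : ℝ × ℝ → ℝ} (hg : Measurable g) (n : ℕ) :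
    Measurable (pairWeight g n) := by
  unfold pairWeight; fun_prop

/-- The integral of `pairWeight` over a set is a probability under a power of the tilted measure. -/
theorem setLIntegral_pairWeight {g : ℝ × ℝ → ℝ} (hg : Measurable g)
    (hg1 : ∫ p, Real.exp (g p) ∂usq = 1) (n : ℕ)
    {S : Set ((Fin n → ℝ) × (Fin n → ℝ))} (hS : MeasurableSet S) :
    ∫⁻ q in S, pairWeight g n q ∂pairLaw n =
      (Measure.pi fun _ : Fin n => usq.tilted g)
        {p | ((fun i => (p i).1, fun i => (p i).2) : (Fin n → ℝ) × (Fin n → ℝ)) ∈ S} := by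
  have hmp := measurePreserving_arrowProdEquivProdArrow ℝ ℝ (Fin n) (fun _ => unif01)
    (fun _ => unif01)
  have hSm : MeasurableSet
      {p : Fin n → ℝ × ℝ | ((fun i => (p i).1, fun i => (p i).2) :
        (Fin n → ℝ) × (Fin n → ℝ)) ∈ S} := hmp.measurable hS
  rw [pi_tilted_eq usq hg1, withDensity_apply _ hSm]
  exact (hmp.setLIntegral_comp_preimage hS (measurable_pairWeight hg n)).symm

theorem measurePreserving_comp_perm {n : ℕ} (σ : Equiv.Perm (Fin n)) :
    MeasurePreserving (fun x : Fin n → ℝ => x ∘ σ) (Measure.pi fun _ => unif01)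
      (Measure.pi fun _ => unif01) := by
  have h := measurePreserving_piCongrLeft (α := fun _ : Fin n => ℝ) (fun _ => unif01) σ.symm
  convert h using 1
  ext x i
  obtain ⟨j, rfl⟩ := σ.symm.surjective i
  rw [MeasurableEquiv.coe_piCongrLeft, Equiv.piCongrLeft_apply_apply]
  simp

theorem factorial_mul_setLIntegral_goodSet {n : ℕ} (δ : ℝ)
    {F : (Fin n → ℝ) × (Fin n → ℝ) → ℝ≥0∞} (hF : Measurable F) :
    (n.factorial : ℝ≥0∞) * ∫⁻ q in goodSet n δ ×ˢ goodSet n δ, F q ∂pairLaw n =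
      ∫⁻ q in goodSet n δ ×ˢ goodSet n δ,
        ∑ σ : Equiv.Perm (Fin n), F (q.1 ∘ σ, q.2) ∂pairLaw n := by
  have hGm : MeasurableSet (goodSet n δ ×ˢ goodSet n δ) :=
    (measurableSet_goodSet n δ).prod (measurableSet_goodSet n δ)
  have hmp : ∀ σ : Equiv.Perm (Fin n), MeasurePreserving
      (fun q : (Fin n → ℝ) × (Fin n → ℝ) => ((q.1 ∘ σ, q.2) : (Fin n → ℝ) × (Fin n → ℝ)))
      (pairLaw n) (pairLaw n) := fun σ =>
    (measurePreserving_comp_perm σ).prod (MeasurePreserving.id _)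
  have hm : ∀ σ : Equiv.Perm (Fin n), Measurable
      (fun q : (Fin n → ℝ) × (Fin n → ℝ) => F (q.1 ∘ σ, q.2)) := fun σ =>
    hF.comp (hmp σ).measurable
  rw [lintegral_finsetSum _ fun σ _ => hm σ]
  have h : ∀ σ : Equiv.Perm (Fin n),
      ∫⁻ q in goodSet n δ ×ˢ goodSet n δ, F (q.1 ∘ σ, q.2) ∂pairLaw n =
        ∫⁻ q in goodSet n δ ×ˢ goodSet n δ, F q ∂pairLaw n := by
    intro σ
    rw [← (hmp σ).setLIntegral_comp_preimage hGm hF]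
    congr 2
    ext q
    simp [comp_mem_goodSet_iff]
  simp_rw [h]
  simp [Fintype.card_perm]

/-- For a function of two tuples invariant under simultaneous relabelling, summing over relabellings
of one tuple can be done after sorting both tuples. -/
theorem sum_perm_comp_eq {n : ℕ} {M : Type*} [AddCommMonoid M]
    {F : (Fin n → ℝ) × (Fin n → ℝ) → M}
    (hF : ∀ (κ : Equiv.Perm (Fin n)) x y, F (x ∘ κ, y ∘ κ) = F (x, y))
    (α β : Equiv.Perm (Fin n)) (x y : Fin n → ℝ) :
    ∑ σ : Equiv.Perm (Fin n), F (x ∘ σ, y) =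
      ∑ π : Equiv.Perm (Fin n), F (x ∘ α, (y ∘ β) ∘ π) := by
  let e : Equiv.Perm (Fin n) ≃ Equiv.Perm (Fin n) :=
    ((Equiv.inv _).trans (Equiv.mulLeft α)).trans (Equiv.mulRight β⁻¹)
  rw [← Equiv.sum_comp e]
  refine Finset.sum_congr rfl fun π _ => ?_
  rw [← hF (β * π)]
  congr 2
  ext j
  simp [e]

theorem grid_mem_Icc {n : ℕ} (j : Fin n) : ((j.1 + 1 : ℝ) / n) ∈ Set.Icc (0 : ℝ) 1 := by
  have hn : (0 : ℝ) < n := by exact_mod_cast j.pos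
  refine ⟨by positivity, ?_⟩
  rw [div_le_one hn]
  exact_mod_cast j.2

/-- `g` varies by at most `ω` between points of the unit square at coordinatewise distance at
most `δ`. -/
def ModulusLE (g : ℝ × ℝ → ℝ) (δ ω : ℝ) : Prop :=
  ∀ p ∈ unitSq, ∀ q ∈ unitSq, |p.1 - q.1| ≤ δ → |p.2 - q.2| ≤ δ → |g p - g q| ≤ ω

theorem abs_sum_sub_permStat_le {g : ℝ × ℝ → ℝ} {δ ω : ℝ} (hg : ModulusLE g δ ω) {n : ℕ}
    {x y : Fin n → ℝ}
    (hx : ∀ j, x j ∈ Set.Icc (0 : ℝ) 1 ∧ |x j - (j.1 + 1 : ℝ) / n| ≤ δ)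
    (hy : ∀ j, y j ∈ Set.Icc (0 : ℝ) 1 ∧ |y j - (j.1 + 1 : ℝ) / n| ≤ δ)
    (π : Equiv.Perm (Fin n)) :
    |∑ i, g (x i, (y ∘ π) i) - permStat g n π| ≤ n * ω := by
  rw [permStat, ← Finset.sum_sub_distrib]
  refine (Finset.abs_sum_le_sum_abs _ _).trans ?_
  refine (Finset.sum_le_card_nsmul _ _ ω fun i _ => ?_).trans (by simp)
  exact hg _ ⟨(hx i).1, (hy _).1⟩ _ ⟨grid_mem_Icc _, grid_mem_Icc _⟩ (hx i).2 (hy _).2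

theorem factorial_mul_tilted_goodSet_le {g : ℝ × ℝ → ℝ} (hg : Measurable g)
    {δ ω : ℝ} (hδ : ModulusLE g δ ω) (n : ℕ) :
    (n.factorial : ℝ≥0∞) * ∫⁻ q in goodSet n δ ×ˢ goodSet n δ, pairWeight g n q ∂pairLaw n ≤
      ENNReal.ofReal (Real.exp (n * ω) *
        ∑ π : Equiv.Perm (Fin n), Real.exp (permStat g n π)) := by
  rw [factorial_mul_setLIntegral_goodSet δ (measurable_pairWeight hg n)]
  calc _ ≤ ∫⁻ q in goodSet n δ ×ˢ goodSet n δ, ENNReal.ofReal (Real.exp (n * ω) *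
        ∑ π : Equiv.Perm (Fin n), Real.exp (permStat g n π)) ∂pairLaw n := by
        refine setLIntegral_mono measurable_const ?_
        rintro ⟨x, y⟩ ⟨⟨α, hα⟩, ⟨β, hβ⟩⟩
        rw [sum_perm_comp_eq (F := pairWeight g n) _ α β x y]
        · rw [Finset.mul_sum, ENNReal.ofReal_sum_of_nonneg fun _ _ => by positivity]
          refine Finset.sum_le_sum fun π _ => ENNReal.ofReal_le_ofReal ?_
          rw [← Real.exp_add]
          have := abs_le.1 (abs_sum_sub_permStat_le hδ (x := x ∘ α) (y := y ∘ β) hα hβ π)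
          exact Real.exp_le_exp.2 (by linarith [this.2])
        · intro κ x y
          simp only [pairWeight, Function.comp_apply]
          rw [Equiv.sum_comp κ fun i => g (x i, y i)]
    _ ≤ _ := by
        rw [setLIntegral_const]
        exact mul_le_of_le_one_right' prob_le_one

open scoped Classical in
theorem mul_goodSet_le_factorial_mul {g φ : ℝ × ℝ → ℝ} (hg : Measurable g) (hφ : Measurable φ)
    {δ ω ε m : ℝ} (hδ : ModulusLE g δ ω) (hδφ : ModulusLE φ δ (ε / 2)) {n : ℕ} (hn : 0 < n) :
    ENNReal.ofReal (Real.exp (-(n * ω)) * ∑ π : Equiv.Perm (Fin n),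
        if ε < |permStat φ n π / n - m| then Real.exp (permStat g n π) else 0) *
      pairLaw n (goodSet n δ ×ˢ goodSet n δ) ≤
    (n.factorial : ℝ≥0∞) *
      ∫⁻ q in {q | ε / 2 ≤ |(∑ i, φ (q.1 i, q.2 i)) / n - m|}, pairWeight g n q ∂pairLaw n := by
  set C : Set ((Fin n → ℝ) × (Fin n → ℝ)) := {q | ε / 2 ≤ |(∑ i, φ (q.1 i, q.2 i)) / n - m|}
    with hC
  have hn' : (0 : ℝ) < n := by exact_mod_cast hn
  have hCm : MeasurableSet C :=
    measurableSet_le measurable_const (by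
      simp_rw [← Real.norm_eq_abs]
      fun_prop)
  have hFm : Measurable (C.indicator (pairWeight g n)) := (measurable_pairWeight hg n).indicator hCm
  calc _ = ∫⁻ q in goodSet n δ ×ˢ goodSet n δ, ENNReal.ofReal (Real.exp (-(n * ω)) *
        ∑ π : Equiv.Perm (Fin n), if ε < |permStat φ n π / n - m| then
          Real.exp (permStat g n π) else 0) ∂pairLaw n := by rw [setLIntegral_const]
    _ ≤ ∫⁻ q in goodSet n δ ×ˢ goodSet n δ, ∑ σ : Equiv.Perm (Fin n),
        C.indicator (pairWeight g n) (q.1 ∘ σ, q.2) ∂pairLaw n := by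
        refine setLIntegral_mono' ((measurableSet_goodSet n δ).prod (measurableSet_goodSet n δ)) ?_
        rintro ⟨x, y⟩ ⟨⟨α, hα⟩, ⟨β, hβ⟩⟩
        simp only
        rw [sum_perm_comp_eq (F := C.indicator (pairWeight g n)) _ α β x y]
        · rw [Finset.mul_sum, ENNReal.ofReal_sum_of_nonneg fun _ _ => by positivity]
          refine Finset.sum_le_sum fun π _ => ?_
          split_ifs with h
          · have h1 := abs_le.1 (abs_sum_sub_permStat_le hδ (x := x ∘ α) (y := y ∘ β) hα hβ π)
            have h2 := abs_sum_sub_permStat_le hδφ (x := x ∘ α) (y := y ∘ β) hα hβ π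
            rw [Set.indicator_of_mem]
            · rw [← Real.exp_add]
              exact ENNReal.ofReal_le_ofReal (Real.exp_le_exp.2 (by linarith [h1.1]))
            · simp only [hC, Set.mem_ofPred_eq]
              have h3 : |(∑ i, φ ((x ∘ α) i, ((y ∘ β) ∘ π) i)) / n - permStat φ n π / n|
                  ≤ ε / 2 := by
                rw [← sub_div, abs_div, abs_of_pos hn', div_le_iff₀ hn']
                linarith
              have h4 := abs_sub_le (permStat φ n π / n)
                ((∑ i, φ ((x ∘ α) i, ((y ∘ β) ∘ π) i)) / n) m
              rw [abs_sub_comm (permStat φ n π / n) ((∑ i, _) / (n : ℝ))] at h4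
              linarith
          · simp
        · intro κ x y
          simp only [Set.indicator_apply, hC, Set.mem_ofPred_eq, pairWeight, Function.comp_apply]
          rw [Equiv.sum_comp κ fun i => g (x i, y i), Equiv.sum_comp κ fun i => φ (x i, y i)]
    _ = (n.factorial : ℝ≥0∞) *
        ∫⁻ q in goodSet n δ ×ˢ goodSet n δ, C.indicator (pairWeight g n) q ∂pairLaw n :=
        (factorial_mul_setLIntegral_goodSet δ hFm).symm
    _ ≤ (n.factorial : ℝ≥0∞) * ∫⁻ q, C.indicator (pairWeight g n) q ∂pairLaw n := by
        gcongr; exact Measure.restrict_le_self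
    _ = _ := by rw [lintegral_indicator hCm]

theorem isCompact_unitSq : IsCompact unitSq := isCompact_Icc.prod isCompact_Icc

theorem exists_modulusLE {g : ℝ × ℝ → ℝ} (hg : ContinuousOn g unitSq) {ω : ℝ} (hω : 0 < ω) :
    ∃ δ > 0, ModulusLE g δ ω := by
  obtain ⟨δ, hδ, h⟩ := Metric.uniformContinuousOn_iff.1
    (isCompact_unitSq.uniformContinuousOn_of_continuous hg) ω hω
  refine ⟨δ / 2, by positivity, fun p hp q hq h1 h2 => ?_⟩
  have := h p hp q hq (by
    rw [Prod.dist_eq, max_lt_iff, Real.dist_eq, Real.dist_eq]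
    constructor <;> linarith)
  rw [Real.dist_eq] at this
  exact this.le

theorem ModulusLE.mono {g : ℝ × ℝ → ℝ} {δ δ' ω : ℝ} (h : ModulusLE g δ ω) (hδ : δ' ≤ δ) :
    ModulusLE g δ' ω :=
  fun p hp q hq h1 h2 => h p hp q hq (h1.trans hδ) (h2.trans hδ)

theorem pi_map_coord_eq {μ : Measure (ℝ × ℝ)} [IsProbabilityMeasure μ] {pr : ℝ × ℝ → ℝ}
    (hpr : Measurable pr) (h : μ.map pr = unif01) (n : ℕ) :
    (Measure.pi fun _ : Fin n => μ).map (fun p i => pr (p i)) =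
      Measure.pi fun _ : Fin n => unif01 := by
  have : ∀ _ : Fin n, SigmaFinite (μ.map pr) := fun _ => by rw [h]; infer_instance
  rw [Measure.pi_map_pi (f := fun _ => pr) fun _ => hpr.aemeasurable]
  simp_rw [h]

theorem pi_real_pair_goodSet_ge {μ : Measure (ℝ × ℝ)} (hμ : μ ∈ MM) [IsProbabilityMeasure μ]
    (n : ℕ) (δ : ℝ) :
    1 - 2 * (Measure.pi fun _ : Fin n => unif01).real (goodSet n δ)ᶜ ≤
      (Measure.pi fun _ : Fin n => μ).real
        {p | ((fun i => (p i).1, fun i => (p i).2) : (Fin n → ℝ) × (Fin n → ℝ)) ∈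
          goodSet n δ ×ˢ goodSet n δ} := by
  have hG := measurableSet_goodSet n δ
  set A : Set (Fin n → ℝ × ℝ) := {p | ((fun i => (p i).1, fun i => (p i).2) :
    (Fin n → ℝ) × (Fin n → ℝ)) ∈ goodSet n δ ×ˢ goodSet n δ} with hA
  have hm1 : Measurable fun (p : Fin n → ℝ × ℝ) i => (p i).1 := by fun_prop
  have hm2 : Measurable fun (p : Fin n → ℝ × ℝ) i => (p i).2 := by fun_prop
  have hAm : MeasurableSet A := (hm1.prodMk hm2) (hG.prod hG)
  have hc : Aᶜ ⊆ (fun p i => (p i).1) ⁻¹' (goodSet n δ)ᶜ ∪ (fun p i => (p i).2) ⁻¹' (goodSet n δ)ᶜ := by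
    intro p hp
    by_contra hcon
    simp only [Set.mem_union, Set.mem_preimage, Set.mem_compl_iff, not_or, not_not] at hcon
    exact hp hcon
  have h1 : (Measure.pi fun _ : Fin n => μ).real ((fun p i => (p i).1) ⁻¹' (goodSet n δ)ᶜ) =
      (Measure.pi fun _ : Fin n => unif01).real (goodSet n δ)ᶜ := by
    rw [← pi_map_coord_eq measurable_fst hμ.2.1 n, map_measureReal_apply hm1 hG.compl]
  have h2 : (Measure.pi fun _ : Fin n => μ).real ((fun p i => (p i).2) ⁻¹' (goodSet n δ)ᶜ) =
      (Measure.pi fun _ : Fin n => unif01).real (goodSet n δ)ᶜ := by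
    rw [← pi_map_coord_eq measurable_snd hμ.2.2 n, map_measureReal_apply hm2 hG.compl]
  have h3 := (measureReal_mono (μ := Measure.pi fun _ : Fin n => μ) hc).trans
    (measureReal_union_le _ _)
  rw [probReal_compl_eq_one_sub hAm, h1, h2] at h3
  linarith

theorem usq_mem_MM : usq ∈ MM := by
  refine ⟨inferInstance, ?_, ?_⟩ <;> simp [usq]

theorem pairLaw_real_goodSet_ge (n : ℕ) (δ : ℝ) :
    1 - 2 * (Measure.pi fun _ : Fin n => unif01).real (goodSet n δ)ᶜ ≤
      (pairLaw n).real (goodSet n δ ×ˢ goodSet n δ) := by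
  refine (pi_real_pair_goodSet_ge usq_mem_MM n δ).trans (le_of_eq ?_)
  have h := setLIntegral_pairWeight (g := fun _ => 0) measurable_const (by simp) n
    ((measurableSet_goodSet n δ).prod (measurableSet_goodSet n δ))
  rw [Measure.real, Measure.real, show usq.tilted (fun _ => 0) = usq by simp] at *
  rw [← h]
  simp [pairWeight]

open scoped Classical in
/-- Under the weights `exp (permStat g)`, where `exp g` is a doubly stochastic density, empirical
averages over the graph of a permutation concentrate. -/
theorem tendsto_weighted_deviation {g φ : ℝ × ℝ → ℝ} (hg : Measurable g)
    (hgc : ContinuousOn g unitSq) (hg1 : ∫ p, Real.exp (g p) ∂usq = 1) (hμ : usq.tilted g ∈ MM)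
    (hφ : Measurable φ) (hφc : ContinuousOn φ unitSq) {B : ℝ} (hB : ∀ p, |φ p| ≤ B)
    {ε : ℝ} (hε : 0 < ε) :
    Tendsto (fun n : ℕ => (∑ π : Equiv.Perm (Fin n),
        if ε < |permStat φ n π / n - ∫ p, φ p ∂usq.tilted g| then
          Real.exp (permStat g n π) else 0) /
        ∑ π : Equiv.Perm (Fin n), Real.exp (permStat g n π)) atTop (𝓝 0) := by
  have : IsProbabilityMeasure (usq.tilted g) := hμ.1
  set m := ∫ p, φ p ∂usq.tilted g with hm
  obtain ⟨c, hc, hdev⟩ := pi_deviation_le (usq.tilted g) hφ hB (half_pos hε)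
  obtain ⟨δ₁, hδ₁, hmod₁⟩ := exists_modulusLE hgc (ω := c / 4) (by positivity)
  obtain ⟨δ₂, hδ₂, hmod₂⟩ := exists_modulusLE hφc (half_pos hε)
  set δ := min δ₁ δ₂
  have hδ : 0 < δ := lt_min hδ₁ hδ₂
  have hgm := hmod₁.mono (min_le_left δ₁ δ₂)
  have hφm := hmod₂.mono (min_le_right δ₁ δ₂)
  have hlim : Tendsto (fun n : ℕ => 8 * Real.exp (-(c / 2) * n)) atTop (𝓝 0) := by
    have h1 : Tendsto (fun n : ℕ => -(c / 2) * (n : ℝ)) atTop atBot :=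
      tendsto_natCast_atTop_atTop.const_mul_atTop_of_neg (by linarith)
    simpa using (Real.tendsto_exp_atBot.comp h1).const_mul 8
  refine squeeze_zero' (Eventually.of_forall fun n => ?_) ?_ hlim
  · refine div_nonneg (Finset.sum_nonneg fun π _ => ?_)
      (Finset.sum_nonneg fun π _ => (Real.exp_pos _).le)
    split_ifs <;> positivity
  filter_upwards [eventually_gt_atTop 0,
    (tendsto_pi_compl_goodSet hδ).eventually (gt_mem_nhds (show (0 : ℝ) < 1 / 4 by norm_num))]
    with n hn hgood
  have hG2 := (measurableSet_goodSet n δ).prod (measurableSet_goodSet n δ)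
  have hU := factorial_mul_tilted_goodSet_le hg hgm n
  have hL := mul_goodSet_le_factorial_mul (m := m) hg hφ hgm hφm hn
  have hCm : MeasurableSet {q : (Fin n → ℝ) × (Fin n → ℝ) |
      ε / 2 ≤ |(∑ i, φ (q.1 i, q.2 i)) / n - m|} :=
    measurableSet_le measurable_const (by
      simp_rw [← Real.norm_eq_abs]
      fun_prop)
  rw [setLIntegral_pairWeight hg hg1 n hG2] at hU
  rw [setLIntegral_pairWeight hg hg1 n hCm] at hL
  set Z := ∑ π : Equiv.Perm (Fin n), Real.exp (permStat g n π)
  set N := ∑ π : Equiv.Perm (Fin n),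
    if ε < |permStat φ n π / n - m| then Real.exp (permStat g n π) else 0
  have hZ : 0 < Z := Finset.sum_pos (fun _ _ => Real.exp_pos _) Finset.univ_nonempty
  have hN : 0 ≤ N := Finset.sum_nonneg fun π _ => by split_ifs <;> positivity
  have hU' := ENNReal.toReal_mono ENNReal.ofReal_ne_top hU
  have hL' := ENNReal.toReal_mono
    (ENNReal.mul_ne_top (ENNReal.natCast_ne_top _) (measure_ne_top _ _)) hL
  rw [ENNReal.toReal_mul, ENNReal.toReal_ofReal (by positivity), ENNReal.toReal_natCast] at hU'
  rw [ENNReal.toReal_mul, ENNReal.toReal_mul, ENNReal.toReal_ofReal (by positivity),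
    ENNReal.toReal_natCast] at hL'
  have hhalf : (1 : ℝ) / 2 ≤
      1 - 2 * (Measure.pi fun _ : Fin n => unif01).real (goodSet n δ)ᶜ := by linarith
  have hP := hhalf.trans (pi_real_pair_goodSet_ge hμ n δ)
  have hW := hhalf.trans (pairLaw_real_goodSet_ge n δ)
  have hf : (0 : ℝ) < n.factorial := by exact_mod_cast n.factorial_pos
  have e1 : (n.factorial : ℝ) * (1 / 2) ≤ Real.exp (n * (c / 4)) * Z :=
    (mul_le_mul_of_nonneg_left hP hf.le).trans hU'
  have e2 : Real.exp (-(n * (c / 4))) * N * (1 / 2) ≤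
      n.factorial * (2 * Real.exp (-c * n)) :=
    (mul_le_mul_of_nonneg_left hW (by positivity)).trans
      (hL'.trans (mul_le_mul_of_nonneg_left (hdev n) hf.le))
  rw [div_le_iff₀ hZ]
  have e3 : N = Real.exp (n * (c / 4)) * (Real.exp (-(n * (c / 4))) * N) := by
    rw [← mul_assoc, ← Real.exp_add]; simp
  have e4 : Real.exp (-(c / 2) * n) =
      Real.exp (n * (c / 4)) * Real.exp (n * (c / 4)) * Real.exp (-c * n) := by
    rw [← Real.exp_add, ← Real.exp_add]; ring_nf
  calc N = Real.exp (n * (c / 4)) * (Real.exp (-(n * (c / 4))) * N) := e3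
    _ ≤ Real.exp (n * (c / 4)) * (8 * Real.exp (-c * n) * (n.factorial * (1 / 2))) := by
        refine mul_le_mul_of_nonneg_left ?_ (Real.exp_pos _).le
        linarith
    _ ≤ Real.exp (n * (c / 4)) * (8 * Real.exp (-c * n) * (Real.exp (n * (c / 4)) * Z)) := by
        gcongr
    _ = _ := by rw [e4]; ring

theorem MM.ae_mem_unitSq {ν : Measure (ℝ × ℝ)} (hν : ν ∈ MM) : ∀ᵐ p ∂ν, p ∈ unitSq := by
  have h1 : ∀ᵐ p ∂ν, p.1 ∈ Set.Icc (0 : ℝ) 1 :=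
    ae_of_ae_map measurable_fst.aemeasurable (hν.2.1 ▸ unif01_ae_mem)
  have h2 : ∀ᵐ p ∂ν, p.2 ∈ Set.Icc (0 : ℝ) 1 :=
    ae_of_ae_map measurable_snd.aemeasurable (hν.2.2 ▸ unif01_ae_mem)
  filter_upwards [h1, h2] with p hp1 hp2 using ⟨hp1, hp2⟩

theorem MM.integral_congr {ν : Measure (ℝ × ℝ)} (hν : ν ∈ MM) {f F : ℝ × ℝ → ℝ}
    (hF : Set.EqOn f F unitSq) : ∫ p, f p ∂ν = ∫ p, F p ∂ν :=
  integral_congr_ae ((MM.ae_mem_unitSq hν).mono fun _ hp => hF hp)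

/-- The exponent `θ F(x,y) + a(x) + b(y)`. -/
def potential (θ : ℝ) (F : BoundedContinuousFunction (ℝ × ℝ) ℝ)
    (a b : BoundedContinuousFunction ℝ ℝ) (p : ℝ × ℝ) : ℝ :=
  θ * F p + a p.1 + b p.2

section Potential

variable {θ : ℝ} {F : BoundedContinuousFunction (ℝ × ℝ) ℝ}
  {a b : BoundedContinuousFunction ℝ ℝ}

theorem continuous_potential : Continuous (potential θ F a b) := by
  unfold potential
  fun_prop

theorem exists_abs_potential_le : ∃ M, ∀ p, |potential θ F a b p| ≤ M := by
  refine ⟨|θ| * ‖F‖ + ‖a‖ + ‖b‖, fun p => ?_⟩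
  have h1 : |θ * F p| ≤ |θ| * ‖F‖ := by
    rw [abs_mul]
    exact mul_le_mul_of_nonneg_left (F.norm_coe_le_norm p) (abs_nonneg _)
  exact (abs_add_three _ _ _).trans
    (add_le_add_three h1 (a.norm_coe_le_norm p.1) (b.norm_coe_le_norm p.2))

theorem integrable_potential (ν : Measure (ℝ × ℝ)) [IsFiniteMeasure ν] :
    Integrable (potential θ F a b) ν := by
  obtain ⟨M, hM⟩ := exists_abs_potential_le (θ := θ) (F := F) (a := a) (b := b)
  exact Integrable.of_bound continuous_potential.aestronglyMeasurable M (.of_forall hM)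

theorem integrable_exp_potential (ν : Measure (ℝ × ℝ)) [IsFiniteMeasure ν] :
    Integrable (fun p => Real.exp (potential θ F a b p)) ν := by
  obtain ⟨M, hM⟩ := exists_abs_potential_le (θ := θ) (F := F) (a := a) (b := b)
  refine Integrable.of_bound (Real.continuous_exp.comp
    continuous_potential).aestronglyMeasurable (Real.exp M) (.of_forall fun p => ?_)
  rw [Real.norm_eq_abs, Real.abs_exp]
  exact Real.exp_le_exp.2 ((le_abs_self _).trans (hM p))

theorem integral_potential {f : ℝ × ℝ → ℝ} (hF : Set.EqOn f F unitSq) {ν : Measure (ℝ × ℝ)}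
    (hν : ν ∈ MM) : ∫ p, potential θ F a b p ∂ν =
      θ * ∫ p, f p ∂ν + (∫ x, a x ∂unif01 + ∫ y, b y ∂unif01) := by
  have := hν.1
  have ha : Integrable (fun p : ℝ × ℝ => a p.1) ν :=
    Integrable.of_bound (by fun_prop) ‖a‖ (.of_forall fun p => a.norm_coe_le_norm p.1)
  have hb : Integrable (fun p : ℝ × ℝ => b p.2) ν :=
    Integrable.of_bound (by fun_prop) ‖b‖ (.of_forall fun p => b.norm_coe_le_norm p.2)
  have hFi : Integrable (fun p => θ * F p) ν := (F.integrable ν).const_mul θ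
  have hFa : Integrable (fun p => θ * F p + a p.1) ν := hFi.add ha
  have h1 : ∫ p : ℝ × ℝ, a p.1 ∂ν = ∫ x, a x ∂unif01 := by
    rw [← hν.2.1, integral_map measurable_fst.aemeasurable a.continuous.aestronglyMeasurable]
  have h2 : ∫ p : ℝ × ℝ, b p.2 ∂ν = ∫ x, b x ∂unif01 := by
    rw [← hν.2.2, integral_map measurable_snd.aemeasurable b.continuous.aestronglyMeasurable]
  unfold potential
  rw [integral_add hFa hb, integral_add hFi ha, integral_const_mul, h1, h2,
    MM.integral_congr hν hF, add_assoc]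

theorem integral_exp_potential_eq_one
    (hrow : ∀ x, ∫ y, Real.exp (potential θ F a b (x, y)) ∂unif01 = 1) :
    ∫ p, Real.exp (potential θ F a b p) ∂usq = 1 := by
  rw [usq, integral_prod _ (integrable_exp_potential usq)]
  simp [hrow]

theorem tilted_potential_mem_MM
    (hrow : ∀ x, ∫ y, Real.exp (potential θ F a b (x, y)) ∂unif01 = 1)
    (hcol : ∀ y, ∫ x, Real.exp (potential θ F a b (x, y)) ∂unif01 = 1) :
    usq.tilted (potential θ F a b) ∈ MM := by
  have h1 := integral_exp_potential_eq_one hrow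
  have hm : Measurable fun p => ENNReal.ofReal (Real.exp (potential θ F a b p)) :=
    (Real.continuous_exp.comp continuous_potential).measurable.ennreal_ofReal
  have hint := integrable_exp_potential (θ := θ) (F := F) (a := a) (b := b) usq
  have hslice : ∀ {e : ℝ → ℝ × ℝ}, Continuous e →
      ∫ y, Real.exp (potential θ F a b (e y)) ∂unif01 = 1 →
      ∫⁻ y, ENNReal.ofReal (Real.exp (potential θ F a b (e y))) ∂unif01 = 1 := by
    intro e he h
    obtain ⟨M, hM⟩ := exists_abs_potential_le (θ := θ) (F := F) (a := a) (b := b)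
    rw [← ofReal_integral_eq_lintegral_ofReal, h, ENNReal.ofReal_one]
    · refine Integrable.of_bound (Real.continuous_exp.comp
        (continuous_potential.comp he)).aestronglyMeasurable (Real.exp M) (.of_forall fun p => ?_)
      rw [Real.norm_eq_abs, Real.abs_exp]
      exact Real.exp_le_exp.2 ((le_abs_self _).trans (hM _))
    · exact .of_forall fun _ => (Real.exp_pos _).le
  refine ⟨isProbabilityMeasure_tilted hint, ?_, ?_⟩
  · ext s hs
    rw [Measure.map_apply measurable_fst hs, tilted_apply' _ _ (measurable_fst hs), h1]
    simp only [div_one]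
    rw [← lintegral_indicator (measurable_fst hs), usq,
      lintegral_prod _ (hm.indicator (measurable_fst hs)).aemeasurable]
    have : ∀ x, ∫⁻ y, (Prod.fst ⁻¹' s).indicator
        (fun p => ENNReal.ofReal (Real.exp (potential θ F a b p))) (x, y) ∂unif01 =
        s.indicator 1 x := by
      intro x
      by_cases hx : x ∈ s
      · simpa [Set.indicator, hx] using hslice (Continuous.prodMk_right x) (hrow x)
      · simp [Set.indicator, hx]
    simp_rw [this]
    exact lintegral_indicator_one hs
  · ext s hs
    rw [Measure.map_apply measurable_snd hs, tilted_apply' _ _ (measurable_snd hs), h1]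
    simp only [div_one]
    rw [← lintegral_indicator (measurable_snd hs), usq,
      lintegral_prod_symm _ (hm.indicator (measurable_snd hs)).aemeasurable]
    have : ∀ y, ∫⁻ x, (Prod.snd ⁻¹' s).indicator
        (fun p => ENNReal.ofReal (Real.exp (potential θ F a b p))) (x, y) ∂unif01 =
        s.indicator 1 y := by
      intro y
      by_cases hy : y ∈ s
      · simpa [Set.indicator, hy] using hslice (Continuous.prodMk_left y) (hcol y)
      · simp [Set.indicator, hy]
    simp_rw [this]
    exact lintegral_indicator_one hs

theorem objE_tilted_potential {f : ℝ × ℝ → ℝ} (hF : Set.EqOn f F unitSq)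
    (h1 : ∫ p, Real.exp (potential θ F a b p) ∂usq = 1)
    (hμ : usq.tilted (potential θ F a b) ∈ MM) :
    objE f θ (usq.tilted (potential θ F a b)) =
      ((-(∫ x, a x ∂unif01 + ∫ y, b y ∂unif01) : ℝ) : EReal) := by
  have := hμ.1
  have hint := integrable_exp_potential (θ := θ) (F := F) (a := a) (b := b) usq
  set μ := usq.tilted (potential θ F a b) with hμdef
  have hac : μ ≪ usq := tilted_absolutelyContinuous _ _
  have hllr : llr μ usq =ᵐ[μ] potential θ F a b := by
    filter_upwards [hac.ae_le (log_rnDeriv_tilted_left_self hint)] with p hp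
    rw [llr_def]
    exact hp.trans (by rw [h1, Real.log_one, sub_zero])
  have hli : Integrable (llr μ usq) μ := (integrable_potential μ).congr hllr.symm
  have hnn := InformationTheory.integral_llr_add_sub_measure_univ_nonneg hac hli
  simp only [probReal_univ, add_sub_cancel_right] at hnn
  rw [objE, KL, if_pos ⟨hac, hli⟩]
  change _ - ((ENNReal.ofReal (∫ p, llr μ usq p ∂μ) : ℝ≥0∞) : EReal) = _
  rw [EReal.coe_ennreal_ofReal, max_eq_left hnn, ← EReal.coe_sub, integral_congr_ae hllr,
    integral_potential hF hμ]
  congr 1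
  ring

/-- Gibbs variational principle: the tilted measure strictly maximizes the objective. -/
theorem objE_le_and_eq_of_ge {f : ℝ × ℝ → ℝ} (hF : Set.EqOn f F unitSq)
    (h1 : ∫ p, Real.exp (potential θ F a b p) ∂usq = 1)
    (hμ : usq.tilted (potential θ F a b) ∈ MM) {ν : Measure (ℝ × ℝ)} (hν : ν ∈ MM) :
    objE f θ ν ≤ objE f θ (usq.tilted (potential θ F a b)) ∧
      (objE f θ (usq.tilted (potential θ F a b)) ≤ objE f θ ν →
        ν = usq.tilted (potential θ F a b)) := by
  rw [objE_tilted_potential hF h1 hμ]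
  have := hμ.1
  have := hν.1
  have hint := integrable_exp_potential (θ := θ) (F := F) (a := a) (b := b) usq
  by_cases h : ν ≪ usq ∧ Integrable (llr ν usq) ν
  · obtain ⟨hac, hli⟩ := h
    have hpi := integrable_potential (θ := θ) (F := F) (a := a) (b := b) ν
    have hac' : ν ≪ usq.tilted (potential θ F a b) :=
      hac.trans (absolutelyContinuous_tilted hint)
    have hli' := integrable_llr_tilted_right hac hpi hli hint
    have heq := integral_llr_tilted_right hac hpi hint hli
    rw [h1, Real.log_one, add_zero, integral_potential hF hν] at heq
    have hnn := InformationTheory.integral_llr_add_sub_measure_univ_nonneg hac hli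
    have hnn' := InformationTheory.integral_llr_add_sub_measure_univ_nonneg hac' hli'
    have hkl := InformationTheory.klDiv_of_ac_of_integrable hac' hli'
    simp only [probReal_univ, add_sub_cancel_right] at hnn hnn' hkl
    have hobj : objE f θ ν = ((θ * ∫ p, f p ∂ν - ∫ p, llr ν usq p ∂ν : ℝ) : EReal) := by
      rw [objE, KL, if_pos ⟨hac, hli⟩]
      change _ - ((ENNReal.ofReal (∫ p, llr ν usq p ∂ν) : ℝ≥0∞) : EReal) = _
      rw [EReal.coe_ennreal_ofReal, max_eq_left hnn, ← EReal.coe_sub]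
    rw [hobj, EReal.coe_le_coe_iff, EReal.coe_le_coe_iff]
    refine ⟨by linarith, fun hge => ?_⟩
    rw [← InformationTheory.klDiv_eq_zero_iff, hkl, ENNReal.ofReal_eq_zero]
    linarith
  · have hobj : objE f θ ν = ⊥ := by
      rw [llr_def] at h
      rw [objE, KL, if_neg h]
      simp
    rw [hobj]
    exact ⟨bot_le, fun hge => absurd (le_bot_iff.1 hge) (EReal.coe_ne_bot _)⟩

end Potential

section Sinkhorn

open BoundedContinuousFunction

theorem integrable_exp_slice (k : (ℝ × ℝ) →ᵇ ℝ) (a : ℝ →ᵇ ℝ) (y : ℝ) :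
    Integrable (fun x => Real.exp (k (x, y) + a x)) unif01 := by
  refine Integrable.of_bound (by fun_prop) (Real.exp (‖k‖ + ‖a‖)) (.of_forall fun x => ?_)
  rw [Real.norm_eq_abs, Real.abs_exp]
  exact Real.exp_le_exp.2 (add_le_add ((le_abs_self _).trans (k.norm_coe_le_norm _))
    ((le_abs_self _).trans (a.norm_coe_le_norm _)))

theorem abs_log_integral_exp_slice_le (k : (ℝ × ℝ) →ᵇ ℝ) (a : ℝ →ᵇ ℝ) (y : ℝ) :
    |Real.log (∫ x, Real.exp (k (x, y) + a x) ∂unif01)| ≤ ‖k‖ + ‖a‖ := by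
  have hb : ∀ x, |k (x, y) + a x| ≤ ‖k‖ + ‖a‖ := fun x =>
    (abs_add_le _ _).trans (add_le_add (k.norm_coe_le_norm _) (a.norm_coe_le_norm _))
  have hi := integrable_exp_slice k a y
  have h1 : Real.exp (-(‖k‖ + ‖a‖)) ≤ ∫ x, Real.exp (k (x, y) + a x) ∂unif01 := by
    have := integral_mono (integrable_const (μ := unif01) (Real.exp (-(‖k‖ + ‖a‖)))) hi
      fun x => Real.exp_le_exp.2 (abs_le.1 (hb x)).1
    simpa using this
  have h2 : ∫ x, Real.exp (k (x, y) + a x) ∂unif01 ≤ Real.exp (‖k‖ + ‖a‖) := by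
    have := integral_mono hi (integrable_const (μ := unif01) (Real.exp (‖k‖ + ‖a‖)))
      fun x => Real.exp_le_exp.2 (abs_le.1 (hb x)).2
    simpa using this
  have hpos := (Real.exp_pos _).trans_le h1
  exact abs_le.2 ⟨(Real.le_log_iff_exp_le hpos).2 h1, (Real.log_le_iff_le_exp hpos).2 h2⟩

/-- One half-step of Sinkhorn's iteration: `y ↦ -log ∫ exp (k(x,y) + a(x)) dx`. -/
def sinkhornStep (k : (ℝ × ℝ) →ᵇ ℝ) (a : ℝ →ᵇ ℝ) : ℝ →ᵇ ℝ :=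
  BoundedContinuousFunction.ofNormedAddCommGroup
    (fun y => -Real.log (∫ x, Real.exp (k (x, y) + a x) ∂unif01))
    (by
      refine (Continuous.log ?_ fun y => (integral_exp_pos (integrable_exp_slice k a y)).ne').neg
      refine continuous_of_dominated (bound := fun _ => Real.exp (‖k‖ + ‖a‖))
        (fun y => (integrable_exp_slice k a y).aestronglyMeasurable)
        (fun y => .of_forall fun x => ?_) (integrable_const _) (.of_forall fun x => by fun_prop)
      rw [Real.norm_eq_abs, Real.abs_exp]
      exact Real.exp_le_exp.2 (add_le_add ((le_abs_self _).trans (k.norm_coe_le_norm _))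
        ((le_abs_self _).trans (a.norm_coe_le_norm _))))
    (‖k‖ + ‖a‖)
    (fun y => by rw [norm_neg]; exact abs_log_integral_exp_slice_le k a y)

theorem exp_neg_sinkhornStep (k : (ℝ × ℝ) →ᵇ ℝ) (a : ℝ →ᵇ ℝ) (y : ℝ) :
    Real.exp (-sinkhornStep k a y) = ∫ x, Real.exp (k (x, y) + a x) ∂unif01 := by
  change Real.exp (- -Real.log _) = _
  rw [neg_neg, Real.exp_log (integral_exp_pos (integrable_exp_slice k a y))]

/-- The oscillation of `h` is at most `D`. -/
def OscLE (h : ℝ → ℝ) (D : ℝ) : Prop := ∀ x x', h x - h x' ≤ D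

theorem OscLE.exists_bounds {h : ℝ → ℝ} {D : ℝ} (hD : OscLE h D) :
    ∃ m, ∀ x, m ≤ h x ∧ h x ≤ m + D := by
  have hb : BddBelow (Set.range h) := ⟨h 0 - D, by
    rintro _ ⟨x, rfl⟩
    linarith [hD 0 x]⟩
  refine ⟨⨅ x, h x, fun x => ⟨ciInf_le hb x, ?_⟩⟩
  have : h x - D ≤ ⨅ x, h x := le_ciInf fun x' => by linarith [hD x x']
  linarith

/-- Sinkhorn half-steps contract the oscillation of differences. -/
theorem OscLE.sinkhornStep {k : (ℝ × ℝ) →ᵇ ℝ} {M : ℝ} (hM : ∀ p, |k p| ≤ M) {a a' : ℝ →ᵇ ℝ}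
    {D : ℝ} (hD : OscLE (fun x => a x - a' x) D) :
    OscLE (fun y => sinkhornStep k a y - sinkhornStep k a' y)
      ((1 - Real.exp (-(4 * M))) * D) := by
  obtain ⟨m, hm⟩ := hD.exists_bounds
  have hM0 : 0 ≤ M := (abs_nonneg _).trans (hM 0)
  set c := Real.exp (-(4 * M)) with hc
  have hc0 : 0 < c := Real.exp_pos _
  have hc1 : c ≤ 1 := Real.exp_le_one_iff.2 (by linarith)
  set w : ℝ → ℝ → ℝ := fun y x => Real.exp (k (x, y) + a' x)
  have hwi : ∀ y, Integrable (w y) unif01 := integrable_exp_slice k a'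
  have hw : ∀ y y' x, Real.exp (-(2 * M)) * w y' x ≤ w y x := by
    intro y y' x
    simp only [w]
    rw [← Real.exp_add]
    refine Real.exp_le_exp.2 ?_
    linarith [(abs_le.1 (hM (x, y))).1, (abs_le.1 (hM (x, y'))).2]
  set Z : ℝ → ℝ := fun y => ∫ x, w y x ∂unif01
  set N : ℝ → ℝ := fun y => ∫ x, Real.exp (k (x, y) + a x) ∂unif01
  have hZpos : ∀ y, 0 < Z y := fun y => integral_exp_pos (hwi y)
  have hNi := integrable_exp_slice k a
  have hN : ∀ x y, Real.exp (k (x, y) + a x) = Real.exp (a x - a' x) * w y x := by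
    intro x y
    simp only [w]
    rw [← Real.exp_add]
    congr 1
    ring
  have hZ : ∀ y y', Real.exp (-(2 * M)) * Z y' ≤ Z y := by
    intro y y'
    simp only [Z]
    rw [← integral_const_mul]
    exact integral_mono ((hwi y').const_mul _) (hwi y) (hw y y')
  have hdiff : ∀ y, N y - Real.exp m * Z y =
      ∫ x, (Real.exp (k (x, y) + a x) - Real.exp m * w y x) ∂unif01 := by
    intro y
    rw [integral_sub (hNi y) ((hwi y).const_mul _), integral_const_mul]
  have hdi : ∀ y, Integrable (fun x => Real.exp (k (x, y) + a x) - Real.exp m * w y x) unif01 :=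
    fun y => (hNi y).sub ((hwi y).const_mul _)
  have hge : ∀ x, 0 ≤ Real.exp (a x - a' x) - Real.exp m := fun x =>
    sub_nonneg.2 (Real.exp_le_exp.2 (hm x).1)
  have hdn : ∀ y, 0 ≤ N y - Real.exp m * Z y := by
    intro y
    rw [hdiff]
    refine integral_nonneg fun x => ?_
    simp only [Pi.zero_apply]
    rw [hN, ← sub_mul]
    exact mul_nonneg (hge x) (Real.exp_pos _).le
  have hdle : ∀ y y', Real.exp (-(2 * M)) * (N y' - Real.exp m * Z y') ≤
      N y - Real.exp m * Z y := by
    intro y y'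
    rw [hdiff, hdiff, ← integral_const_mul]
    refine integral_mono ((hdi y').const_mul _) (hdi y) fun x => ?_
    simp only
    rw [hN, hN, ← sub_mul, ← sub_mul, mul_left_comm]
    exact mul_le_mul_of_nonneg_left (hw y y' x) (hge x)
  have hNle : ∀ y, N y ≤ Real.exp (m + D) * Z y := by
    intro y
    simp only [N, Z]
    rw [← integral_const_mul]
    refine integral_mono (hNi y) ((hwi y).const_mul _) fun x => ?_
    simp only
    rw [hN]
    exact mul_le_mul_of_nonneg_right (Real.exp_le_exp.2 (hm x).2) (Real.exp_pos _).le
  set r : ℝ → ℝ := fun y => _root_.sinkhornStep k a' y - _root_.sinkhornStep k a y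
  have hr : ∀ y, N y = Real.exp (r y) * Z y := by
    intro y
    simp only [N, Z, w, r]
    rw [← exp_neg_sinkhornStep, ← exp_neg_sinkhornStep, ← Real.exp_add]
    congr 1
    ring
  have hrD : ∀ y, r y ≤ m + D := by
    intro y
    have := hNle y
    rw [hr] at this
    exact Real.exp_le_exp.1 (le_of_mul_le_mul_right this (hZpos y))
  have hkey : ∀ y y', c * (Real.exp (r y') - Real.exp m) ≤ Real.exp (r y) - Real.exp m := by
    intro y y'
    have h1 := hdle y y'
    have h2 := hdn y'
    rw [hr, ← sub_mul] at h2
    rw [hr, hr, ← sub_mul, ← sub_mul] at h1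
    have h3 : 0 ≤ Real.exp (r y') - Real.exp m := nonneg_of_mul_nonneg_left h2 (hZpos y')
    have h4 := hZ y' y
    have h5 : c = Real.exp (-(2 * M)) * Real.exp (-(2 * M)) := by
      rw [hc, ← Real.exp_add]
      congr 1
      ring
    refine le_of_mul_le_mul_right ?_ (hZpos y)
    calc c * (Real.exp (r y') - Real.exp m) * Z y
        = Real.exp (-(2 * M)) * (Real.exp (r y') - Real.exp m) * (Real.exp (-(2 * M)) * Z y) := by
          rw [h5]; ring
      _ ≤ Real.exp (-(2 * M)) * (Real.exp (r y') - Real.exp m) * Z y' :=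
          mul_le_mul_of_nonneg_left h4 (mul_nonneg (Real.exp_pos _).le h3)
      _ ≤ _ := by linarith
  have hlog : ∀ y y', c * r y' + (1 - c) * m ≤ r y := by
    intro y y'
    have hcv := convexOn_exp.2 (Set.mem_univ (r y')) (Set.mem_univ m) hc0.le
      (sub_nonneg.2 hc1) (by ring)
    simp only [smul_eq_mul] at hcv
    exact Real.exp_le_exp.1 (hcv.trans (by linarith [hkey y y']))
  intro y y'
  have h1 := hlog y y'
  have h2 := mul_le_mul_of_nonneg_left (hrD y') (sub_nonneg.2 hc1)
  simp only [r] at h1 h2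
  linarith

/-- A full Sinkhorn step, normalized to vanish at `0`. -/
def sinkhornMap (k : (ℝ × ℝ) →ᵇ ℝ) (a : ℝ →ᵇ ℝ) : ℝ →ᵇ ℝ :=
  sinkhornStep (k.compContinuous ⟨Prod.swap, continuous_swap⟩) (sinkhornStep k a) -
    BoundedContinuousFunction.const ℝ
      (sinkhornStep (k.compContinuous ⟨Prod.swap, continuous_swap⟩) (sinkhornStep k a) 0)

theorem OscLE.sinkhornMap {k : (ℝ × ℝ) →ᵇ ℝ} {a a' : ℝ →ᵇ ℝ}
    {D : ℝ} (hD : OscLE (fun x => a x - a' x) D) :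
    OscLE (fun y => sinkhornMap k a y - sinkhornMap k a' y)
      ((1 - Real.exp (-(4 * ‖k‖))) ^ 2 * D) := by
  have h := (hD.sinkhornStep (k := k) k.norm_coe_le_norm).sinkhornStep
    (k := k.compContinuous ⟨Prod.swap, continuous_swap⟩) (M := ‖k‖)
    (fun p => k.norm_coe_le_norm p.swap)
  intro x x'
  have := h x x'
  simp only [_root_.sinkhornMap, BoundedContinuousFunction.coe_sub, Pi.sub_apply,
    BoundedContinuousFunction.const_apply]
  rw [sq, mul_assoc]
  linarith

theorem sinkhornMap_zero (k : (ℝ × ℝ) →ᵇ ℝ) (a : ℝ →ᵇ ℝ) : sinkhornMap k a 0 = 0 := by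
  simp [sinkhornMap]

theorem exists_isFixedPt_sinkhornMap (k : (ℝ × ℝ) →ᵇ ℝ) :
    ∃ a, Function.IsFixedPt (sinkhornMap k) a := by
  set ρ := (1 - Real.exp (-(4 * ‖k‖))) ^ 2 with hρ
  have hc0 : 0 < Real.exp (-(4 * ‖k‖)) := Real.exp_pos _
  have hc1 : Real.exp (-(4 * ‖k‖)) ≤ 1 :=
    Real.exp_le_one_iff.2 (by linarith [norm_nonneg k])
  have hρ0 : 0 ≤ ρ := sq_nonneg _
  have hρ1 : ρ < 1 := by rw [hρ]; nlinarith
  have hosc : ∀ (n : ℕ) (a a' : ℝ →ᵇ ℝ), OscLE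
      (fun y => (sinkhornMap k)^[n] a y - (sinkhornMap k)^[n] a' y) (ρ ^ n * (2 * dist a a')) := by
    intro n a a'
    induction n with
    | zero =>
      intro x x'
      have h1 := abs_le.1 ((Real.dist_eq _ _).symm.trans_le (a.dist_coe_le_dist (g := a') x))
      have h2 := abs_le.1 ((Real.dist_eq _ _).symm.trans_le (a.dist_coe_le_dist (g := a') x'))
      simp only [Function.iterate_zero, id_eq, pow_zero, one_mul]
      linarith
    | succ n ih =>
      simp only [Function.iterate_succ', Function.comp_apply]
      have := ih.sinkhornMap (k := k)
      rwa [← mul_assoc, ← pow_succ'] at this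
  obtain ⟨n, hn⟩ := exists_pow_lt_of_lt_one (show (0 : ℝ) < 1 / 2 by norm_num) hρ1
  have hn1 : 2 * ρ ^ (n + 1) < 1 := by
    have : ρ ^ (n + 1) ≤ ρ ^ n := pow_le_pow_of_le_one hρ0 hρ1.le (Nat.le_succ n)
    linarith
  have hK : 0 ≤ 2 * ρ ^ (n + 1) := by positivity
  have hcontr : ContractingWith ⟨2 * ρ ^ (n + 1), hK⟩ (sinkhornMap k)^[n + 1] := by
    refine ⟨hn1, LipschitzWith.of_dist_le_mul fun a a' => ?_⟩
    refine (BoundedContinuousFunction.dist_le (mul_nonneg hK dist_nonneg)).2 fun x => ?_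
    have h0 : ∀ b, (sinkhornMap k)^[n + 1] b 0 = 0 := fun b => by
      rw [Function.iterate_succ', Function.comp_apply, sinkhornMap_zero]
    have h1 := hosc (n + 1) a a' x 0
    have h2 := hosc (n + 1) a a' 0 x
    simp only [h0] at h1 h2
    rw [Real.dist_eq, abs_le]
    change -(2 * ρ ^ (n + 1) * dist a a') ≤ _ ∧ _ ≤ 2 * ρ ^ (n + 1) * dist a a'
    constructor <;> linarith
  exact ⟨_, hcontr.isFixedPt_fixedPoint_iterate⟩

/-- Existence of bounded continuous Schrödinger potentials. -/
theorem exists_potentials (θ : ℝ) (F : (ℝ × ℝ) →ᵇ ℝ) :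
    ∃ a b : ℝ →ᵇ ℝ,
      (∀ x, ∫ y, Real.exp (potential θ F a b (x, y)) ∂unif01 = 1) ∧
      ∀ y, ∫ x, Real.exp (potential θ F a b (x, y)) ∂unif01 = 1 := by
  obtain ⟨a, ha⟩ := exists_isFixedPt_sinkhornMap (θ • F)
  set b := sinkhornStep (θ • F) a with hb
  set c := sinkhornStep ((θ • F).compContinuous ⟨Prod.swap, continuous_swap⟩) b 0
  have hcol : ∀ y, ∫ x, Real.exp (potential θ F a b (x, y)) ∂unif01 = 1 := by
    intro y
    have h : ∀ x, Real.exp (potential θ F a b (x, y)) =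
        Real.exp (b y) * Real.exp ((θ • F) (x, y) + a x) := by
      intro x
      rw [← Real.exp_add, add_comm (b y)]
      rfl
    simp_rw [h]
    rw [integral_const_mul, ← exp_neg_sinkhornStep, ← Real.exp_add, ← hb, add_neg_cancel,
      Real.exp_zero]
  have hrow : ∀ x, ∫ y, Real.exp (potential θ F a b (x, y)) ∂unif01 = Real.exp (-c) := by
    intro x
    have h : ∀ y, Real.exp (potential θ F a b (x, y)) = Real.exp (a x) * Real.exp
        (((θ • F).compContinuous ⟨Prod.swap, continuous_swap⟩) (y, x) + b y) := by
      intro y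
      rw [← Real.exp_add, potential]
      congr 1
      simp
      ring
    have hax : a x = sinkhornStep ((θ • F).compContinuous ⟨Prod.swap, continuous_swap⟩) b x - c :=
      (DFunLike.congr_fun ha x).symm
    simp_rw [h]
    rw [integral_const_mul, ← exp_neg_sinkhornStep, ← Real.exp_add, hax]
    congr 1
    ring
  have hc : Real.exp (-c) = 1 := by
    have hi := integrable_exp_potential (θ := θ) (F := F) (a := a) (b := b) usq
    have h1 : ∫ p, Real.exp (potential θ F a b p) ∂usq = Real.exp (-c) := by
      rw [usq, integral_prod _ hi]
      simp [hrow]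
    have h2 : ∫ p, Real.exp (potential θ F a b p) ∂usq = 1 := by
      rw [usq, integral_prod_symm _ hi]
      simp [hcol]
    rw [← h1, h2]
  exact ⟨a, b, fun x => (hrow x).trans hc, hcol⟩

end Sinkhorn

/-- A continuous function on the unit square extends to a bounded continuous function. -/
theorem exists_bounded_extension {f : ℝ × ℝ → ℝ} (hf : ContinuousOn f unitSq) :
    ∃ F : BoundedContinuousFunction (ℝ × ℝ) ℝ, Set.EqOn f F unitSq := by
  set r : ℝ × ℝ → ℝ × ℝ := fun p =>
    (Set.projIcc (0 : ℝ) 1 zero_le_one p.1, Set.projIcc (0 : ℝ) 1 zero_le_one p.2)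
  have hr : Continuous r := by
    have := continuous_projIcc (a := (0 : ℝ)) (b := 1) (h := zero_le_one)
    fun_prop
  have hrm : ∀ p, r p ∈ unitSq := fun p => ⟨Subtype.coe_prop _, Subtype.coe_prop _⟩
  obtain ⟨B, hB⟩ := isCompact_unitSq.exists_bound_of_continuousOn hf
  refine ⟨BoundedContinuousFunction.ofNormedAddCommGroup (f ∘ r)
    (hf.comp_continuous hr hrm) B fun p => hB _ (hrm p), fun p hp => ?_⟩
  have : r p = p := Prod.ext (by simp [r, Set.projIcc_of_mem zero_le_one hp.1])
    (by simp [r, Set.projIcc_of_mem zero_le_one hp.2])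
  simp [this]

theorem permStat_congr {f F : ℝ × ℝ → ℝ} (h : Set.EqOn f F unitSq) (n : ℕ)
    (π : Equiv.Perm (Fin n)) : permStat f n π = permStat F n π :=
  Finset.sum_congr rfl fun i _ => h ⟨grid_mem_Icc i, grid_mem_Icc (π i)⟩

theorem permStat_potential {f : ℝ × ℝ → ℝ} {θ : ℝ} {F : BoundedContinuousFunction (ℝ × ℝ) ℝ}
    {a b : BoundedContinuousFunction ℝ ℝ} (hF : Set.EqOn f F unitSq) (n : ℕ)
    (π : Equiv.Perm (Fin n)) :
    permStat (potential θ F a b) n π = θ * permStat f n π +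
      (∑ i : Fin n, a ((i.1 + 1 : ℝ) / n) + ∑ i : Fin n, b ((i.1 + 1 : ℝ) / n)) := by
  rw [permStat_congr hF, ← Equiv.sum_comp π fun i : Fin n => b ((i.1 + 1 : ℝ) / n)]
  simp only [permStat, potential, Finset.sum_add_distrib, Finset.mul_sum, add_assoc]

open scoped Classical in
theorem Qprob_eq_div {f g : ℝ × ℝ → ℝ} {θ : ℝ} {n : ℕ} {C : ℝ}
    (hg : ∀ π, permStat g n π = θ * permStat f n π + C) (p : Equiv.Perm (Fin n) → Prop) :
    Qprob f θ n p = (∑ π, if p π then Real.exp (permStat g n π) else 0) /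
      ∑ π, Real.exp (permStat g n π) := by
  have hZ : 0 < ∑ π : Equiv.Perm (Fin n), Real.exp (θ * permStat f n π) :=
    Finset.sum_pos (fun _ _ => Real.exp_pos _) Finset.univ_nonempty
  have h1 : ∀ π, Real.exp (permStat g n π) = Real.exp (θ * permStat f n π) * Real.exp C := by
    intro π
    rw [hg, Real.exp_add]
  simp_rw [h1, ← Finset.sum_mul, Qprob, Zn, Real.exp_sub, Real.exp_log hZ]
  rw [Finset.sum_div]
  refine Finset.sum_congr rfl fun π _ => ?_
  split_ifs
  · rw [mul_div_mul_right _ _ (Real.exp_pos C).ne']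
  · rw [zero_div]

/-- For `f ∈ 𝓒` and `θ ∈ ℝ`, the objective `μ ↦ θ μ[f] − D(μ‖u)` has a
unique maximizer `μ_{f,θ}` over `𝓜`, and for `π ∼ Q_{n,f,θ}` the empirical measure `ν_π`
converges weakly in probability to `μ_{f,θ}`. -/
theorem unique_maximizer_and_weak_convergence (f : ℝ × ℝ → ℝ) (hf : memC f) (θ : ℝ) :
    ∃ μstar ∈ MM,
      (∀ ν ∈ MM, objE f θ ν ≤ objE f θ μstar) ∧
      (∀ ν ∈ MM, (∀ ν' ∈ MM, objE f θ ν' ≤ objE f θ ν) → ν = μstar) ∧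
      (∀ φ : ℝ × ℝ → ℝ, ContinuousOn φ unitSq → ∀ ε > 0,
        Tendsto
          (fun n : ℕ => Qprob f θ n
            (fun π => ε < |permStat φ n π / n - ∫ p, φ p ∂μstar|))
          atTop (𝓝 0)) := by
  obtain ⟨F, hF⟩ := exists_bounded_extension hf.1
  obtain ⟨a, b, hrow, hcol⟩ := exists_potentials θ F
  have h1 := integral_exp_potential_eq_one hrow
  have hμ := tilted_potential_mem_MM hrow hcol
  refine ⟨usq.tilted (potential θ F a b), hμ, fun ν hν => (objE_le_and_eq_of_ge hF h1 hμ hν).1,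
    fun ν hν hmax => (objE_le_and_eq_of_ge hF h1 hμ hν).2 (hmax _ hμ), fun φ hφ ε hε => ?_⟩
  obtain ⟨Φ, hΦ⟩ := exists_bounded_extension hφ
  have := tendsto_weighted_deviation continuous_potential.measurable
    continuous_potential.continuousOn h1 hμ Φ.continuous.measurable Φ.continuous.continuousOn
    Φ.norm_coe_le_norm hε
  refine this.congr fun n => ?_
  rw [Qprob_eq_div (permStat_potential (a := a) (b := b) hF n)]
  simp only [permStat_congr hΦ, MM.integral_congr hμ hΦ]
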